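/- A topological dynamical system (X,T) is continuously strictly pointwise ergodic if and only if it is strictly partitionable and the generic-point partition 𝒫 is upper semicontinuous. -/

import Mathlib

open MeasureTheory Filter Topology Metric

section TopDefs

variable {X : Type*} [MetricSpace X]

/-- The Cesàro (Birkhoff) averages `(1/n) ∑_{i<n} f(Tⁱ x)`. -/
noncomputable def cesaro (T : X → X) (f : X → ℝ) (n : ℕ) (x : X) : ℝ :=
  (n : ℝ)⁻¹ * ∑ i ∈ Finset.range n, f (T^[i] x)

/-- `P` is a partition of `X` (into nonempty sets, every point in exactly one atom). -/
def IsPartition (P : Set (Set X)) : Prop :=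
  (∀ A ∈ P, A.Nonempty) ∧ ∀ x : X, ∃! A : Set X, A ∈ P ∧ x ∈ A

/-- A partition is upper semicontinuous if whenever a sequence of atoms converges in the
Hausdorff metric to a (nonempty compact) set `S`, then `S` is contained in some atom. -/
def PartitionUSC (P : Set (Set X)) : Prop :=
  ∀ A : ℕ → Set X, (∀ n, A n ∈ P) → ∀ S : Set X, S.Nonempty → IsCompact S →
    Tendsto (fun n => hausdorffDist (A n) S) atTop (𝓝 0) → ∃ B ∈ P, S ⊆ B

/-- A partition is lower semicontinuous if whenever a sequence of atoms converges in the
Hausdorff metric to a (nonempty compact) set `S`, then `S` contains some atom. -/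
def PartitionLSC (P : Set (Set X)) : Prop :=
  ∀ A : ℕ → Set X, (∀ n, A n ∈ P) → ∀ S : Set X, S.Nonempty → IsCompact S →
    Tendsto (fun n => hausdorffDist (A n) S) atTop (𝓝 0) → ∃ B ∈ P, B ⊆ S

/-- Upper semicontinuity of a (compact-)set-valued function: if `yₙ → y₀` and
`f(yₙ) → S` in the Hausdorff metric, then `S ⊆ f(y₀)`. -/
def SetValuedUSC {Y : Type*} [MetricSpace Y] (f : Y → Set X) : Prop :=
  ∀ (y : ℕ → Y) (y₀ : Y), Tendsto y atTop (𝓝 y₀) →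
    ∀ S : Set X, S.Nonempty → IsCompact S →
      Tendsto (fun n => hausdorffDist (f (y n)) S) atTop (𝓝 0) → S ⊆ f y₀

/-- Lower semicontinuity of a (compact-)set-valued function: if `yₙ → y₀` and
`f(yₙ) → S` in the Hausdorff metric, then `f(y₀) ⊆ S`. -/
def SetValuedLSC {Y : Type*} [MetricSpace Y] (f : Y → Set X) : Prop :=
  ∀ (y : ℕ → Y) (y₀ : Y), Tendsto y atTop (𝓝 y₀) →
    ∀ S : Set X, S.Nonempty → IsCompact S →
      Tendsto (fun n => hausdorffDist (f (y n)) S) atTop (𝓝 0) → f y₀ ⊆ S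

/-- A set is invariant for the homeomorphism `T` if `T(K) = K`. -/
def IsInvariantSet (T : X ≃ₜ X) (K : Set X) : Prop := T '' K = K

/-- A minimal set: nonempty, closed, invariant, with no proper nonempty closed invariant
subset. -/
def IsMinimalSet (T : X ≃ₜ X) (K : Set X) : Prop :=
  K.Nonempty ∧ IsClosed K ∧ IsInvariantSet T K ∧
    ∀ K' : Set X, K' ⊆ K → K'.Nonempty → IsClosed K' → IsInvariantSet T K' → K' = K

/-- A system is semi-simple if `X` is a union of minimal sets. -/
def SemiSimple (T : X ≃ₜ X) : Prop :=
  ∀ x : X, ∃ K : Set X, IsMinimalSet T K ∧ x ∈ K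

/-- A system is uniform if the Cesàro means of every continuous function converge
uniformly on `X`. -/
def UniformSystem (T : X ≃ₜ X) : Prop :=
  ∀ f : C(X, ℝ), ∃ g : X → ℝ,
    TendstoUniformly (fun n x => cesaro (⇑T) (⇑f) n x) g atTop

/-- Uniformity of the subsystem carried by the set `M`: the Cesàro means of every
continuous function converge uniformly on `M`. -/
def UniformOn (T : X ≃ₜ X) (M : Set X) : Prop :=
  ∀ f : C(X, ℝ), ∃ g : X → ℝ,
    TendstoUniformlyOn (fun n x => cesaro (⇑T) (⇑f) n x) g atTop M

/-- Strictly uniform = uniform + semi-simple. -/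
def StrictlyUniform (T : X ≃ₜ X) : Prop := UniformSystem T ∧ SemiSimple T

end TopDefs

section MeasDefs

variable {X : Type*} [MetricSpace X] [CompactSpace X]
  [MeasurableSpace X] [BorelSpace X]

/-- A `T`-invariant Borel probability measure. -/
def IsInvariantMeasure (T : X ≃ₜ X) (μ : ProbabilityMeasure X) : Prop :=
  μ.toMeasure.map ⇑T = μ.toMeasure

/-- An ergodic `T`-invariant Borel probability measure. -/
def IsErgodicMeasure (T : X ≃ₜ X) (μ : ProbabilityMeasure X) : Prop :=
  Ergodic (⇑T) μ.toMeasure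

/-- `x` is generic for `μ`: the Cesàro means of every continuous function at `x`
converge to the integral of the function against `μ`. -/
def IsGenericFor (T : X ≃ₜ X) (x : X) (μ : ProbabilityMeasure X) : Prop :=
  ∀ f : C(X, ℝ),
    Tendsto (fun n => cesaro (⇑T) (⇑f) n x) atTop (𝓝 (∫ y, f y ∂μ.toMeasure))

/-- Pointwise ergodic: every point is generic for some ergodic measure. -/
def PointwiseErgodic (T : X ≃ₜ X) : Prop :=
  ∀ x : X, ∃ μ : ProbabilityMeasure X, IsErgodicMeasure T μ ∧ IsGenericFor T x μ

/-- The set of points generic for `μ` (a fiber of the map `Φ`). -/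
def genericFiber (T : X ≃ₜ X) (μ : ProbabilityMeasure X) : Set X :=
  {x : X | IsGenericFor T x μ}

/-- The generic-point partition `𝒫`: the (nonempty) fibers of the map `Φ` sending each
point to the ergodic measure it generates. -/
def genericPartition (T : X ≃ₜ X) : Set (Set X) :=
  {A : Set X | ∃ μ : ProbabilityMeasure X, IsErgodicMeasure T μ ∧
    (genericFiber T μ).Nonempty ∧ A = genericFiber T μ}

/-- Continuously pointwise ergodic: every point is generic for an ergodic measure and the
map `Φ` sending each point to that measure is continuous (weak-star topology). -/
def ContinuouslyPointwiseErgodic (T : X ≃ₜ X) : Prop :=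
  ∃ Φ : X → ProbabilityMeasure X, Continuous Φ ∧
    ∀ x : X, IsErgodicMeasure T (Φ x) ∧ IsGenericFor T x (Φ x)

/-- Continuously strictly pointwise ergodic = continuously pointwise ergodic +
semi-simple. -/
def ContinuouslyStrictlyPointwiseErgodic (T : X ≃ₜ X) : Prop :=
  ContinuouslyPointwiseErgodic T ∧ SemiSimple T

/-- The set `K` carries exactly one `T`-invariant Borel probability measure. -/
def UniquelyErgodicOn (T : X ≃ₜ X) (K : Set X) : Prop :=
  ∃! μ : ProbabilityMeasure X, IsInvariantMeasure T μ ∧ μ.toMeasure K = 1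

/-- Partitionable: `X` is a disjoint union of closed invariant uniquely ergodic sets. -/
def Partitionable (T : X ≃ₜ X) : Prop :=
  ∃ P : Set (Set X), IsPartition P ∧
    ∀ K ∈ P, IsClosed K ∧ IsInvariantSet T K ∧ UniquelyErgodicOn T K

/-- Strictly partitionable: `X` is a union of strictly ergodic (minimal and uniquely
ergodic) subsystems. -/
def StrictlyPartitionable (T : X ≃ₜ X) : Prop :=
  ∀ x : X, ∃ K : Set X, x ∈ K ∧ IsMinimalSet T K ∧ UniquelyErgodicOn T K

/-- The topological support of a measure: points all of whose open neighborhoods have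
positive measure (equivalently, the smallest closed set of full measure). -/
def msupp (μ : ProbabilityMeasure X) : Set X :=
  {x : X | ∀ U : Set X, IsOpen U → x ∈ U → 0 < μ.toMeasure U}

/-- The set `ℳ_T^e(X)` of ergodic invariant probability measures. -/
def ErgodicSet (T : X ≃ₜ X) : Set (ProbabilityMeasure X) :=
  {μ : ProbabilityMeasure X | IsErgodicMeasure T μ}

/-- Continuity of the set-valued map `supp : ℳ_T^e(X) → 2^X` (sequentially, via the
Hausdorff metric; `ℳ_T^e(X)` carries the weak-star topology, which is metrizable). -/
def SuppContinuousOnErgodic (T : X ≃ₜ X) : Prop :=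
  ∀ μ ∈ ErgodicSet T, ∀ ν : ℕ → ProbabilityMeasure X,
    (∀ n, ν n ∈ ErgodicSet T) → Tendsto ν atTop (𝓝 μ) →
    Tendsto (fun n => hausdorffDist (msupp (ν n)) (msupp μ)) atTop (𝓝 0)

end MeasDefs
section Helpers

set_option linter.unusedSectionVars false

variable {X : Type*} [MetricSpace X] [CompactSpace X]
  [MeasurableSpace X] [BorelSpace X]

lemma aux_integrable (μ : Measure X) [IsFiniteMeasure μ] (f : C(X, ℝ)) :
    Integrable (fun x => f x) μ :=
  (BoundedContinuousFunction.mkOfCompact f).integrable μ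

lemma aux_tendsto_iff {ι : Type*} {F : Filter ι} {ν : ι → ProbabilityMeasure X}
    {μ : ProbabilityMeasure X} :
    Tendsto ν F (𝓝 μ) ↔ ∀ f : C(X, ℝ),
      Tendsto (fun i => ∫ y, f y ∂(ν i).toMeasure) F (𝓝 (∫ y, f y ∂μ.toMeasure)) := by
  rw [ProbabilityMeasure.tendsto_iff_forall_integral_tendsto]
  constructor
  · intro h f
    exact h (BoundedContinuousFunction.mkOfCompact f)
  · intro h f
    exact h f.toContinuousMap

lemma aux_ext_measure {μ ν : Measure X} [IsFiniteMeasure μ] [IsFiniteMeasure ν]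
    (h : ∀ f : C(X, ℝ), ∫ y, f y ∂μ = ∫ y, f y ∂ν) : μ = ν :=
  ext_of_forall_integral_eq_of_IsFiniteMeasure fun f => h f.toContinuousMap

lemma aux_ext {μ ν : ProbabilityMeasure X}
    (h : ∀ f : C(X, ℝ), ∫ y, f y ∂μ.toMeasure = ∫ y, f y ∂ν.toMeasure) : μ = ν :=
  Subtype.ext (aux_ext_measure (μ := μ.toMeasure) (ν := ν.toMeasure) h)

lemma aux_generic_unique {T : X ≃ₜ X} {x : X} {μ ν : ProbabilityMeasure X}
    (h : IsGenericFor T x μ) (h' : IsGenericFor T x ν) : μ = ν :=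
  aux_ext fun f => tendsto_nhds_unique (h f) (h' f)

lemma aux_inv_iff {T : X ≃ₜ X} {μ : ProbabilityMeasure X} :
    IsInvariantMeasure T μ ↔
      ∀ f : C(X, ℝ), ∫ y, f (T y) ∂μ.toMeasure = ∫ y, f y ∂μ.toMeasure := by
  have key : ∀ f : C(X, ℝ), ∫ y, f y ∂(μ.toMeasure.map ⇑T) = ∫ y, f (T y) ∂μ.toMeasure := by
    intro f
    exact integral_map T.continuous.measurable.aemeasurable
      f.continuous.aestronglyMeasurable
  constructor
  · intro h f
    rw [← key f, h]
  · intro h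
    have : IsFiniteMeasure (μ.toMeasure.map ⇑T) := Measure.isFiniteMeasure_map _ _
    refine aux_ext_measure fun f => ?_
    rw [key f, h f]

/-- distance to a set as a continuous map -/
noncomputable def auxDist (K : Set X) : C(X, ℝ) := ⟨fun x => infDist x K, continuous_infDist_pt K⟩

lemma aux_supp {K : Set X} (hK : IsClosed K) (hne : K.Nonempty) {μ : ProbabilityMeasure X}
    (h : ∫ y, auxDist K y ∂μ.toMeasure = 0) : μ.toMeasure K = 1 := by
  have h1 := (integral_eq_zero_iff_of_nonneg (f := fun y => auxDist K y)
    (fun y => infDist_nonneg) (aux_integrable μ.toMeasure _)).1 h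
  have h2 : ∀ᵐ y ∂μ.toMeasure, y ∈ K := by
    filter_upwards [h1] with y hy
    exact (hK.mem_iff_infDist_zero hne).2 hy
  exact (prob_compl_eq_zero_iff hK.measurableSet).1 h2

lemma aux_limit {T : X ≃ₜ X} {K : Set X} (hK : IsClosed K) (hne : K.Nonempty)
    {μ : ProbabilityMeasure X}
    (hu : ∀ ν : ProbabilityMeasure X, IsInvariantMeasure T ν ∧ ν.toMeasure K = 1 → ν = μ)
    {ι : Type*} {F : Filter ι} {ν : ι → ProbabilityMeasure X}
    (hinv : ∀ f : C(X, ℝ), Tendsto (fun i => ∫ y, f (T y) ∂(ν i).toMeasure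
      - ∫ y, f y ∂(ν i).toMeasure) F (𝓝 0))
    (hs : Tendsto (fun i => ∫ y, auxDist K y ∂(ν i).toMeasure) F (𝓝 0)) :
    Tendsto ν F (𝓝 μ) := by
  rw [tendsto_iff_ultrafilter]
  intro g hg
  obtain ⟨ρ, -, hρ⟩ := isCompact_univ.ultrafilter_le_nhds (g.map ν) (by simp)
  have hρ' : Tendsto ν g (𝓝 ρ) := hρ
  have hint := aux_tendsto_iff.1 hρ'
  have : ρ = μ := by
    apply hu
    constructor
    · rw [aux_inv_iff]
      intro f
      have h1 := hint (f.comp ⟨T, T.continuous⟩)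
      have h2 := hint f
      have h3 := tendsto_nhds_unique ((hinv f).mono_left hg) (h1.sub h2)
      have h4 : ∫ y, (f.comp ⟨T, T.continuous⟩ : C(X, ℝ)) y ∂ρ.toMeasure
        = ∫ y, f (T y) ∂ρ.toMeasure := rfl
      linarith
    · exact aux_supp hK hne (tendsto_nhds_unique (hint _) (hs.mono_left hg))
  rw [← this]
  exact hρ'

/-- empirical measures -/
noncomputable def auxEmp (T : X ≃ₜ X) (x : X) (n : ℕ) : ProbabilityMeasure X :=
  ⟨((n + 1 : ℕ) : ENNReal)⁻¹ • ∑ i ∈ Finset.range (n + 1), Measure.dirac (T^[i] x), by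
    constructor
    simp only [Measure.smul_apply, Measure.coe_finsetSum, Finset.sum_apply, measure_univ,
      Finset.sum_const, Finset.card_range, smul_eq_mul, nsmul_eq_mul, mul_one]
    exact ENNReal.inv_mul_cancel (by simp) (by simp)⟩

lemma auxEmp_integral (T : X ≃ₜ X) (x : X) (n : ℕ) (f : C(X, ℝ)) :
    ∫ y, f y ∂(auxEmp T x n).toMeasure = cesaro T f (n + 1) x := by
  have : (auxEmp T x n).toMeasure
    = ((n + 1 : ℕ) : ENNReal)⁻¹ • ∑ i ∈ Finset.range (n + 1), Measure.dirac (T^[i] x) := rfl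
  rw [this, integral_smul_measure, integral_finsetSum_measure]
  · simp only [cesaro, integral_dirac, ENNReal.toReal_inv, ENNReal.toReal_natCast, smul_eq_mul]
  · intro i _
    exact aux_integrable _ _

lemma aux_cesaro_shift (T : X → X) (f : C(X, ℝ)) (x : X) (n : ℕ) :
    cesaro T (fun y => f (T y)) n x - cesaro T f n x = (n : ℝ)⁻¹ * (f (T^[n] x) - f x) := by
  unfold cesaro
  rw [← mul_sub, ← Finset.sum_sub_distrib]
  congr 1
  have := Finset.sum_range_sub (fun i => f (T^[i] x)) n
  simp only [Function.iterate_succ_apply'] at this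
  simpa using this

lemma aux_shift_tendsto (T : X → X) (f : C(X, ℝ)) (x : X) :
    Tendsto (fun n => cesaro T (fun y => f (T y)) n x - cesaro T f n x) atTop (𝓝 0) := by
  simp only [aux_cesaro_shift]
  refine squeeze_zero_norm (a := fun n : ℕ => (n : ℝ)⁻¹ * (‖f‖ + ‖f‖)) ?_ ?_
  · intro n
    rw [norm_mul]
    gcongr
    · simp
    · exact (norm_sub_le _ _).trans (add_le_add (f.norm_coe_le_norm _) (f.norm_coe_le_norm _))
  · simpa using (tendsto_inv_atTop_nhds_zero_nat (𝕜 := ℝ)).mul_const (‖f‖ + ‖f‖)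

lemma aux_inv_mem {T : X ≃ₜ X} {K : Set X} (h : IsInvariantSet T K) {x : X} :
    T x ∈ K ↔ x ∈ K := by
  constructor
  · intro hx
    rw [← h] at hx
    obtain ⟨y, hy, e⟩ := hx
    exact T.injective e ▸ hy
  · intro hx
    rw [← h]
    exact ⟨x, hx, rfl⟩

lemma aux_iter_mem {T : X ≃ₜ X} {K : Set X} (h : IsInvariantSet T K) {x : X} (hx : x ∈ K) (n : ℕ) :
    T^[n] x ∈ K := by
  induction n with
  | zero => simpa
  | succ n ih => rw [Function.iterate_succ_apply']; exact (aux_inv_mem h).2 ih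

lemma aux_inv_of_mem {T : X ≃ₜ X} {K : Set X} (h : ∀ x, T x ∈ K ↔ x ∈ K) : IsInvariantSet T K := by
  ext y
  constructor
  · rintro ⟨x, hx, rfl⟩
    exact (h x).2 hx
  · intro hy
    exact ⟨T.symm y, (h _).1 (by simpa), by simp⟩

lemma aux_cesaro_dist {T : X ≃ₜ X} {K : Set X} (h : IsInvariantSet T K) {x : X} (hx : x ∈ K)
    (n : ℕ) : cesaro T (auxDist K) n x = 0 := by
  unfold cesaro
  rw [Finset.sum_eq_zero, mul_zero]
  intro i _
  exact infDist_zero_of_mem (aux_iter_mem h hx i)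

lemma aux_generic {T : X ≃ₜ X} {K : Set X} (hK : IsClosed K) (hKi : IsInvariantSet T K)
    {μ : ProbabilityMeasure X}
    (hu : ∀ ν : ProbabilityMeasure X, IsInvariantMeasure T ν ∧ ν.toMeasure K = 1 → ν = μ)
    {x : X} (hx : x ∈ K) : IsGenericFor T x μ := by
  have := aux_limit (F := atTop) (ν := auxEmp T x) hK ⟨x, hx⟩ hu ?_ ?_
  · intro f
    rw [← tendsto_add_atTop_iff_nat 1]
    simpa only [auxEmp_integral] using aux_tendsto_iff.1 this f
  · intro f
    have h1 := (tendsto_add_atTop_iff_nat 1).2 (aux_shift_tendsto T f x)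
    refine h1.congr fun n => ?_
    rw [auxEmp_integral]
    congr 1
    exact (auxEmp_integral T x n (f.comp ⟨T, T.continuous⟩)).symm
  · simp only [auxEmp_integral, aux_cesaro_dist hKi hx]
    exact tendsto_const_nhds

lemma aux_ergodic {T : X ≃ₜ X} {K : Set X} {μ : ProbabilityMeasure X}
    (hi : IsInvariantMeasure T μ) (hμ : μ.toMeasure K = 1)
    (hK : IsClosed K)
    (hu : ∀ ν : ProbabilityMeasure X, IsInvariantMeasure T ν ∧ ν.toMeasure K = 1 → ν = μ) :
    IsErgodicMeasure T μ := by
  have mp : MeasurePreserving T μ.toMeasure μ.toMeasure := ⟨T.continuous.measurable, hi⟩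
  refine ⟨mp, ⟨?_⟩⟩
  intro s hs hTs
  by_cases h0 : μ.toMeasure s = 0
  · rw [eventuallyConst_set']
    left
    exact ae_eq_empty.2 h0
  have : IsProbabilityMeasure (ProbabilityTheory.cond μ.toMeasure s) :=
    ProbabilityTheory.cond_isProbabilityMeasure h0
  have h1 := hu ⟨ProbabilityTheory.cond μ.toMeasure s, this⟩ ⟨?_, ?_⟩
  · have h2 : (ProbabilityTheory.cond μ.toMeasure s) s = μ.toMeasure s :=
      congrArg (fun ν : ProbabilityMeasure X => ν.toMeasure s) h1
    rw [ProbabilityTheory.cond_apply_self h0 (measure_ne_top _ _)] at h2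
    rw [eventuallyConst_set']
    right
    exact ae_eq_univ.2 ((prob_compl_eq_zero_iff hs).2 h2.symm)
  · show Measure.map T (ProbabilityTheory.cond μ.toMeasure s) = ProbabilityTheory.cond μ.toMeasure s
    ext A hA
    rw [Measure.map_apply T.continuous.measurable hA, ProbabilityTheory.cond_apply hs,
      ProbabilityTheory.cond_apply hs]
    congr 1
    rw [← mp.measure_preimage (hs.inter hA).nullMeasurableSet, Set.preimage_inter, hTs]
  · show (ProbabilityTheory.cond μ.toMeasure s) K = 1
    have hc : μ.toMeasure Kᶜ = 0 := (prob_compl_eq_zero_iff hK.measurableSet).2 hμ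
    rw [← prob_compl_eq_zero_iff hK.measurableSet]
    exact ProbabilityTheory.cond_absolutelyContinuous hc

lemma aux_cesaro_le (T : X → X) (f : C(X, ℝ)) (x : X) (n : ℕ) : ‖cesaro T f n x‖ ≤ ‖f‖ := by
  unfold cesaro
  rw [norm_mul]
  have h1 : ‖∑ i ∈ Finset.range n, f (T^[i] x)‖ ≤ n * ‖f‖ := by
    refine (norm_sum_le _ _).trans ?_
    refine (Finset.sum_le_sum fun i _ => f.norm_coe_le_norm _).trans ?_
    simp
  rcases Nat.eq_zero_or_pos n with rfl | hn
  · simp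
  have hn' : (0 : ℝ) < n := by exact_mod_cast hn
  calc ‖(n : ℝ)⁻¹‖ * _ ≤ ‖(n : ℝ)⁻¹‖ * (n * ‖f‖) := by gcongr
    _ = ‖f‖ := by
      rw [Real.norm_of_nonneg (by positivity)]
      field_simp

lemma aux_cesaro_integral {T : X ≃ₜ X} {ν : ProbabilityMeasure X} (hν : IsInvariantMeasure T ν)
    (f : C(X, ℝ)) (n : ℕ) (hn : n ≠ 0) :
    ∫ y, cesaro T f n y ∂ν.toMeasure = ∫ y, f y ∂ν.toMeasure := by
  unfold cesaro
  have hc : ∀ i, Continuous (T^[i]) := fun i => T.continuous.iterate i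
  have h1 : ∀ i, ∫ y, f (T^[i] y) ∂ν.toMeasure = ∫ y, f y ∂ν.toMeasure := by
    intro i
    induction i with
    | zero => simp
    | succ i ih =>
      rw [← ih]
      exact aux_inv_iff.1 hν (f.comp ⟨T^[i], hc i⟩)
  rw [integral_const_mul, integral_finsetSum]
  · simp only [h1, Finset.sum_const, Finset.card_range, nsmul_eq_mul]
    field_simp
  · intro i _
    exact aux_integrable _ (f.comp ⟨T^[i], hc i⟩)

lemma aux_unique {T : X ≃ₜ X} {K : Set X} {μ ν : ProbabilityMeasure X} (hK : IsClosed K)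
    (hg : ∀ y ∈ K, IsGenericFor T y μ) (hν : IsInvariantMeasure T ν) (h1 : ν.toMeasure K = 1) :
    ν = μ := by
  refine aux_ext fun f => ?_
  have hae : ∀ᵐ y ∂ν.toMeasure, y ∈ K := (prob_compl_eq_zero_iff hK.measurableSet).2 h1
  have ht : Tendsto (fun n => ∫ y, cesaro T f n y ∂ν.toMeasure) atTop
      (𝓝 (∫ _y, (∫ z, f z ∂μ.toMeasure) ∂ν.toMeasure)) := by
    refine tendsto_integral_of_dominated_convergence (fun _ => ‖f‖) ?_ (integrable_const _) ?_ ?_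
    · intro n
      have : Continuous (fun y => cesaro T f n y) := by
        unfold cesaro
        have hc : ∀ i, Continuous (T^[i]) := fun i => T.continuous.iterate i
        exact continuous_const.mul (continuous_finsetSum _ fun i _ => f.continuous.comp (hc i))
      exact this.aestronglyMeasurable
    · intro n
      exact Eventually.of_forall fun y => aux_cesaro_le T f y n
    · filter_upwards [hae] with y hy
      exact hg y hy f
  have ht2 : Tendsto (fun n => ∫ y, cesaro T f n y ∂ν.toMeasure) atTop
      (𝓝 (∫ y, f y ∂ν.toMeasure)) := by
    refine tendsto_const_nhds.congr' ?_
    filter_upwards [eventually_ne_atTop 0] with n hn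
    exact (aux_cesaro_integral hν f n hn).symm
  have := tendsto_nhds_unique ht2 ht
  simpa using this

lemma aux_generic_shift {T : X ≃ₜ X} {x : X} {μ : ProbabilityMeasure X} :
    IsGenericFor T (T x) μ ↔ IsGenericFor T x μ := by
  have key : ∀ (f : C(X, ℝ)) n, cesaro T f n (T x) = cesaro T (fun y => f (T y)) n x := by
    intro f n
    unfold cesaro
    simp only [← Function.iterate_succ_apply, ← Function.iterate_succ_apply']
  constructor
  · intro h f
    have h1 := (h f).sub (aux_shift_tendsto T f x)
    simpa [key] using h1
  · intro h f
    have h1 := (h f).add (aux_shift_tendsto T f x)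
    simpa [key] using h1

lemma aux_fin {A B : Set X} (hA : A.Nonempty) (hB : B.Nonempty) : hausdorffEDist A B ≠ ⊤ :=
  hausdorffEDist_ne_top_of_nonempty_of_bounded hA hB (isBounded_of_compactSpace)
    (isBounded_of_compactSpace)

lemma aux_forward (T : X ≃ₜ X) (h : ContinuouslyStrictlyPointwiseErgodic T) :
    StrictlyPartitionable T ∧ PartitionUSC (genericPartition T) := by
  obtain ⟨⟨Φ, hc, hΦ⟩, hss⟩ := h
  have hshift : ∀ x, Φ (T x) = Φ x := fun x =>
    aux_generic_unique (aux_generic_shift.1 (hΦ (T x)).2) (hΦ x).2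
  have hfib : ∀ {x μ}, IsGenericFor T x μ → Φ x = μ := fun h => aux_generic_unique (hΦ _).2 h
  constructor
  · intro x
    obtain ⟨K, hK, hx⟩ := hss x
    obtain ⟨hne, hcl, hi, hmin⟩ := id hK
    refine ⟨K, hx, hK, ?_⟩
    have heq : K ∩ Φ ⁻¹' {Φ x} = K := by
      refine hmin _ Set.inter_subset_left ⟨x, hx, rfl⟩
        (hcl.inter (isClosed_singleton.preimage hc)) (aux_inv_of_mem fun y => ?_)
      simp only [Set.mem_inter_iff, aux_inv_mem hi, Set.mem_preimage, hshift]
    have hg : ∀ y ∈ K, IsGenericFor T y (Φ x) := by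
      intro y hy
      rw [← heq] at hy
      have : Φ y = Φ x := hy.2
      exact this ▸ (hΦ y).2
    refine ⟨Φ x, ⟨(hΦ x).1.map_eq, ?_⟩, ?_⟩
    · apply aux_supp hcl hne
      refine tendsto_nhds_unique ((hΦ x).2 (auxDist K)) ?_
      simp only [aux_cesaro_dist hi hx]
      exact tendsto_const_nhds
    · rintro ν ⟨h1, h2⟩
      exact aux_unique hcl hg h1 h2
  · intro A hA S hS hSc hlim
    choose μ hμ hne hAμ using hA
    have hAne : ∀ n, (A n).Nonempty := fun n => hAμ n ▸ hne n
    have hconv : ∀ s ∈ S, Tendsto μ atTop (𝓝 (Φ s)) := by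
      intro s hs
      have hex : ∀ n : ℕ, ∃ a ∈ A n, dist a s < hausdorffDist (A n) S + 1 / ((n : ℝ) + 1) := by
        intro n
        have hp : (0 : ℝ) < 1 / ((n : ℝ) + 1) := by positivity
        exact exists_dist_lt_of_hausdorffDist_lt' hs (lt_add_of_pos_right _ hp)
          (aux_fin (hAne n) hS)
      choose a ha hd using hex
      have hta : Tendsto a atTop (𝓝 s) := by
        rw [tendsto_iff_dist_tendsto_zero]
        refine squeeze_zero (fun _ => dist_nonneg) (fun n => (hd n).le) ?_
        simpa using hlim.add (tendsto_one_div_add_atTop_nhds_zero_nat (𝕜 := ℝ))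
      have := (hc.tendsto s).comp hta
      refine this.congr fun n => ?_
      have h1 : a n ∈ genericFiber T (μ n) := hAμ n ▸ ha n
      exact hfib h1
    obtain ⟨s, hs⟩ := hS
    refine ⟨genericFiber T (Φ s), ⟨Φ s, (hΦ s).1, ⟨s, (hΦ s).2⟩, rfl⟩, ?_⟩
    intro t ht
    have : Φ t = Φ s := tendsto_nhds_unique (hconv t ht) (hconv s hs)
    exact (this ▸ (hΦ t).2 : IsGenericFor T t (Φ s))

lemma aux_backward (T : X ≃ₜ X) (h : StrictlyPartitionable T)
    (husc : PartitionUSC (genericPartition T)) : ContinuouslyStrictlyPointwiseErgodic T := by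
  refine ⟨?_, fun x => (h x).imp fun K hK => ⟨hK.2.1, hK.1⟩⟩
  choose K hxK hmin hue using h
  choose Φ hΦ hΦu using hue
  have hu : ∀ x, ∀ ν : ProbabilityMeasure X,
      IsInvariantMeasure T ν ∧ ν.toMeasure (K x) = 1 → ν = Φ x := fun x ν hν => hΦu x ν hν
  have hcl : ∀ x, IsClosed (K x) := fun x => (hmin x).2.1
  have hKi : ∀ x, IsInvariantSet T (K x) := fun x => (hmin x).2.2.1
  have hgen : ∀ x, ∀ y ∈ K x, IsGenericFor T y (Φ x) := fun x y hy =>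
    aux_generic (hcl x) (hKi x) (hu x) hy
  have herg : ∀ x, IsErgodicMeasure T (Φ x) := fun x =>
    aux_ergodic (hΦ x).1 (hΦ x).2 (hcl x) (hu x)
  have hfib : ∀ x, genericFiber T (Φ x) = K x := by
    intro x
    apply Set.Subset.antisymm
    · intro y hy
      have e : Φ y = Φ x := aux_generic_unique (hgen y y (hxK y)) hy
      have h1 : (Φ x).toMeasure (K y) = 1 := e ▸ (hΦ y).2
      have hne : (K x ∩ K y).Nonempty := by
        have ha : ∀ᵐ z ∂(Φ x).toMeasure, z ∈ K y :=
          (prob_compl_eq_zero_iff (hcl y).measurableSet).2 h1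
        have hb : ∀ᵐ z ∂(Φ x).toMeasure, z ∈ K x :=
          (prob_compl_eq_zero_iff (hcl x).measurableSet).2 (hΦ x).2
        exact (hb.and ha).exists
      have hinv : IsInvariantSet T (K x ∩ K y) := aux_inv_of_mem fun z => by
        simp only [Set.mem_inter_iff, aux_inv_mem (hKi x), aux_inv_mem (hKi y)]
      have e1 := (hmin y).2.2.2 _ Set.inter_subset_right hne ((hcl x).inter (hcl y)) hinv
      have : y ∈ K x ∩ K y := by rw [e1]; exact hxK y
      exact this.1
    · intro y hy
      exact hgen x y hy
  refine ⟨Φ, ?_, fun x => ⟨herg x, hgen x x (hxK x)⟩⟩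
  rw [continuous_iff_seqContinuous]
  intro x x0 hx
  apply tendsto_of_subseq_tendsto
  intro ns hns
  let C : ℕ → TopologicalSpace.NonemptyCompacts X := fun n =>
    ⟨⟨K (x (ns n)), (hcl _).isCompact⟩, ⟨_, hxK _⟩⟩
  obtain ⟨S, φ, hφ, hS⟩ := CompactSpace.tendsto_subseq C
  refine ⟨φ, ?_⟩
  have hd : Tendsto (fun n => hausdorffDist (K (x (ns (φ n)))) (S : Set X)) atTop (𝓝 0) := by
    have := tendsto_iff_dist_tendsto_zero.1 hS
    refine this.congr fun n => ?_
    rw [Metric.NonemptyCompacts.dist_eq]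
    rfl
  obtain ⟨B, ⟨μ, hμ, -, rfl⟩, hSB⟩ := husc (fun n => K (x (ns (φ n))))
    (fun n => ⟨Φ (x (ns (φ n))), herg _, ⟨_, hgen _ _ (hxK _)⟩, (hfib _).symm⟩)
    S S.nonempty S.isCompact hd
  have hx' : Tendsto (fun n => x (ns (φ n))) atTop (𝓝 x0) :=
    hx.comp (hns.comp hφ.tendsto_atTop)
  have hdist : ∀ n, ∀ y ∈ K (x (ns (φ n))),
      infDist y S ≤ hausdorffDist (K (x (ns (φ n)))) (S : Set X) := fun n y hy =>
    infDist_le_hausdorffDist_of_mem hy (aux_fin ⟨y, hy⟩ S.nonempty)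
  have hx0S : x0 ∈ (S : Set X) := by
    rw [S.isCompact.isClosed.mem_iff_infDist_zero S.nonempty]
    have h1 := ((continuous_infDist_pt (S : Set X)).tendsto x0).comp hx'
    refine tendsto_nhds_unique h1 (squeeze_zero (fun _ => infDist_nonneg) (fun n => ?_) hd)
    exact hdist n _ (hxK _)
  have hμ0 : μ = Φ x0 := aux_generic_unique (hSB hx0S) (hgen x0 x0 (hxK x0))
  rw [hμ0, hfib] at hSB
  refine aux_limit (ν := fun n => Φ (x (ns (φ n)))) (hcl x0) ⟨x0, hxK x0⟩ (hu x0) ?_ ?_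
  · intro f
    have : ∀ n, ∫ y, f (T y) ∂(Φ (x (ns (φ n)))).toMeasure
      - ∫ y, f y ∂(Φ (x (ns (φ n)))).toMeasure = 0 := fun n => by
      rw [aux_inv_iff.1 (hΦ _).1 f, sub_self]
    simp only [this]
    exact tendsto_const_nhds
  · refine squeeze_zero (fun n => integral_nonneg fun y => infDist_nonneg) (fun n => ?_) hd
    have hb : ∀ᵐ z ∂(Φ (x (ns (φ n)))).toMeasure, z ∈ K (x (ns (φ n))) :=
      (prob_compl_eq_zero_iff (hcl _).measurableSet).2 (hΦ _).2
    have : ∫ y, auxDist (K x0) y ∂(Φ (x (ns (φ n)))).toMeasure ≤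
        ∫ _y, hausdorffDist (K (x (ns (φ n)))) (S : Set X) ∂(Φ (x (ns (φ n)))).toMeasure := by
      refine integral_mono_ae (aux_integrable _ _) (integrable_const _) ?_
      filter_upwards [hb] with y hy
      exact (infDist_le_infDist_of_subset hSB S.nonempty).trans (hdist n y hy)
    simpa using this

end Helpers

/-- `(X,T)` is continuously strictly pointwise ergodic iff it is strictly
partitionable and the generic-point partition `𝒫` is upper semicontinuous. -/
theorem stmt_6 {X : Type*} [MetricSpace X] [CompactSpace X]
    [MeasurableSpace X] [BorelSpace X] (T : X ≃ₜ X) :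
    ContinuouslyStrictlyPointwiseErgodic T ↔
      StrictlyPartitionable T ∧ PartitionUSC (genericPartition T) := by
  exact ⟨aux_forward T, fun h => aux_backward T h.1 h.2⟩
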